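/- Let R be a ℂ[∂]-module of the form R = (ℂ[∂] ⊗ V) ⊕ Tor R with V finite-dimensional, and let a ∈ R. In ℒie_p R with the induced generating series a_{λ₁,…,λ_p} = Σ_{m₁,…,m_p ≥ 0} λ₁^{(m₁)}⋯λ_p^{(m_p)} a_{m₁,…,m_p}, one has a_{λ₁,…,λ_p} = 0 (i.e., a_{m₁,…,m_p} = 0 for all m₁,…,m_p ≥ 0) if and only if a ∈ Tor R. -/

import Mathlib

noncomputable section

/-- The operator `∂̃_p = ∂ + ∂_{t₁} + ⋯ + ∂_{t_p}` on `R[t₁^{±1},…,t_p^{±1}]`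
(modelled as `(Fin p → ℤ) →₀ R`) for a `ℂ[∂]`-module `R`. -/
def DtildeP (R : Type*) [AddCommGroup R] [Module ℂ R] [Module (Polynomial ℂ) R]
    [IsScalarTower ℂ (Polynomial ℂ) R] (p : ℕ) :
    ((Fin p → ℤ) →₀ R) →ₗ[ℂ] ((Fin p → ℤ) →₀ R) :=
  Finsupp.lsum ℂ (fun mm : Fin p → ℤ =>
    Finsupp.lsingle mm ∘ₗ
        ((LinearMap.lsmul (Polynomial ℂ) R Polynomial.X).restrictScalars ℂ) +
      ∑ i : Fin p, ((mm i : ℂ)) • Finsupp.lsingle (mm - Pi.single i 1))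

section

open Polynomial

variable {R : Type*} [AddCommGroup R] [Module ℂ R] [Module ℂ[X] R] [IsScalarTower ℂ ℂ[X] R]

theorem DtildeP_single (p : ℕ) (m : Fin p → ℤ) (a : R) :
    DtildeP R p (Finsupp.single m a) = Finsupp.single m ((X : ℂ[X]) • a) +
      ∑ i, (m i : ℂ) • Finsupp.single (m - Pi.single i 1) a := by
  simp [DtildeP]

/-- The nonnegative Fourier coefficients of `a` vanish in `ℒie_p R`. -/
def NonnegCoeffsVanish (p : ℕ) (a : R) : Prop :=
  ∀ m : Fin p → ℤ, (∀ i, 0 ≤ m i) → Finsupp.single m a ∈ LinearMap.range (DtildeP R p)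

theorem sub_piSingle_nonneg {p : ℕ} {m : Fin p → ℤ} (hm : ∀ i, 0 ≤ m i) {j : Fin p}
    (hj : m j ≠ 0) (i : Fin p) : 0 ≤ (m - Pi.single j 1 : Fin p → ℤ) i := by
  have h := hm i
  rcases eq_or_ne i j with rfl | hij
  · simp only [Pi.sub_apply, Pi.single_eq_same]
    omega
  · simpa [hij] using h

theorem NonnegCoeffsVanish.relation {p : ℕ} {c : ℂ} {a : R}
    (h : NonnegCoeffsVanish p ((X - C c : ℂ[X]) • a)) {m : Fin p → ℤ} (hm : ∀ i, 0 ≤ m i) :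
    c • Finsupp.single m a + ∑ i, (m i : ℂ) • Finsupp.single (m - Pi.single i 1) a ∈
      LinearMap.range (DtildeP R p) := by
  have hc : (C c : ℂ[X]) • a = c • a := algebraMap_smul ℂ[X] c a
  have h' := Submodule.sub_mem _ (LinearMap.mem_range_self (DtildeP R p) (Finsupp.single m a))
    (h m hm)
  rw [DtildeP_single, sub_smul, hc, Finsupp.single_sub, ← Finsupp.smul_single c] at h'
  convert h' using 1
  abel

theorem NonnegCoeffsVanish.of_X_sub_C_smul {p : ℕ} (hp : 0 < p) {c : ℂ} {a : R}
    (h : NonnegCoeffsVanish p ((X - C c : ℂ[X]) • a)) : NonnegCoeffsVanish p a := by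
  rcases eq_or_ne c 0 with rfl | hc
  · let i₀ : Fin p := ⟨0, hp⟩
    suffices H : ∀ n : ℕ, ∀ m : Fin p → ℤ, (∀ i, 0 ≤ m i) →
        (∑ i ∈ Finset.univ.erase i₀, m i) = n →
        Finsupp.single m a ∈ LinearMap.range (DtildeP R p) from fun m hm =>
      H _ m hm (Int.toNat_of_nonneg (Finset.sum_nonneg fun i _ => hm i)).symm
    intro n
    induction n using Nat.strong_induction_on with
    | _ n ih =>
    intro m hm hn
    have hm' : ∀ i, 0 ≤ (m + Pi.single i₀ 1 : Fin p → ℤ) i := fun i =>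
      add_nonneg (hm i) (by rcases eq_or_ne i i₀ with rfl | hi <;> simp [*])
    have key := h.relation hm'
    rw [zero_smul, zero_add, ← Finset.add_sum_erase _ _ (Finset.mem_univ i₀)] at key
    have hlow : ∑ i ∈ Finset.univ.erase i₀, (((m + Pi.single i₀ 1 : Fin p → ℤ) i : ℤ) : ℂ) •
        Finsupp.single (m + Pi.single i₀ 1 - Pi.single i 1) a ∈
          LinearMap.range (DtildeP R p) := by
      refine Submodule.sum_mem _ fun j hj => ?_
      by_cases hj0 : (m + Pi.single i₀ 1 : Fin p → ℤ) j = 0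
      · simp [hj0]
      refine Submodule.smul_mem _ _ (ih (n - 1) ?_ _ (sub_piSingle_nonneg hm' hj0) ?_)
      all_goals
        have hji : j ≠ i₀ := Finset.ne_of_mem_erase hj
        have h1 : m j ≤ ∑ i ∈ Finset.univ.erase i₀, m i :=
          Finset.single_le_sum (fun i _ => hm i) hj
        have h2 : m j ≠ 0 := by simpa [hji] using hj0
        have h3 := hm j
      · omega
      · have : ∑ i ∈ Finset.univ.erase i₀, (m + Pi.single i₀ 1 - Pi.single j 1 : Fin p → ℤ) i =
            (∑ i ∈ Finset.univ.erase i₀, m i) - 1 := by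
          simp [Finset.sum_sub_distrib, Finset.sum_add_distrib, hji]
        omega
    have hlead := (Submodule.add_mem_iff_left _ hlow).1 key
    have h0 : (((m + Pi.single i₀ 1 : Fin p → ℤ) i₀ : ℤ) : ℂ) ≠ 0 := by
      have := hm i₀
      have : (m + Pi.single i₀ 1 : Fin p → ℤ) i₀ ≠ 0 := by
        simp only [Pi.add_apply, Pi.single_eq_same]
        omega
      exact_mod_cast this
    rwa [Submodule.smul_mem_iff _ h0, add_sub_cancel_right] at hlead
  · suffices H : ∀ n : ℕ, ∀ m : Fin p → ℤ, (∀ i, 0 ≤ m i) → (∑ i, m i) = n →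
        Finsupp.single m a ∈ LinearMap.range (DtildeP R p) from fun m hm =>
      H _ m hm (Int.toNat_of_nonneg (Finset.sum_nonneg fun i _ => hm i)).symm
    intro n
    induction n using Nat.strong_induction_on with
    | _ n ih =>
    intro m hm hn
    have hlow : ∑ i, (m i : ℂ) • Finsupp.single (m - Pi.single i 1) a ∈
        LinearMap.range (DtildeP R p) := by
      refine Submodule.sum_mem _ fun j hj => ?_
      by_cases hj0 : m j = 0
      · simp [hj0]
      refine Submodule.smul_mem _ _ (ih (n - 1) ?_ _ (sub_piSingle_nonneg hm hj0) ?_)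
      all_goals
        have h1 : m j ≤ ∑ i, m i := Finset.single_le_sum (fun i _ => hm i) hj
        have h3 := hm j
      · omega
      · have : ∑ i, (m - Pi.single j 1 : Fin p → ℤ) i = (∑ i, m i) - 1 := by
          simp [Finset.sum_sub_distrib]
        omega
    exact (Submodule.smul_mem_iff _ hc).1
      ((Submodule.add_mem_iff_left _ hlow).1 (h.relation hm))

theorem NonnegCoeffsVanish.of_smul {p : ℕ} (hp : 0 < p) (f : ℂ[X]) (hf : f ≠ 0) {a : R}
    (h : NonnegCoeffsVanish p (f • a)) : NonnegCoeffsVanish p a := by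
  induction hn : f.natDegree generalizing f with
  | zero =>
    obtain ⟨u, rfl⟩ := natDegree_eq_zero.1 hn
    have hu : u ≠ 0 := by simpa using hf
    intro m hm
    have hc : (C u : ℂ[X]) • a = u • a := algebraMap_smul ℂ[X] u a
    have := h m hm
    rwa [hc, ← Finsupp.smul_single, Submodule.smul_mem_iff _ hu] at this
  | succ n ih =>
    obtain ⟨c, hroot⟩ := IsAlgClosed.exists_root f
      (fun h0 => by simp [natDegree_eq_of_degree_eq_some h0] at hn)
    obtain ⟨g, rfl⟩ := dvd_iff_isRoot.2 hroot
    have hg : g ≠ 0 := right_ne_zero_of_mul hf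
    refine ih g hg (of_X_sub_C_smul hp (c := c) (by rwa [smul_smul])) ?_
    rw [natDegree_mul (X_sub_C_ne_zero c) hg, natDegree_X_sub_C] at hn
    omega

/-- The operator `∂_{t₁} + ⋯ + ∂_{t_p}` on `ℂ[t₁^{±1},…,t_p^{±1}]`. -/
def laurentDeriv (p : ℕ) : ((Fin p → ℤ) →₀ ℂ) →ₗ[ℂ] ((Fin p → ℤ) →₀ ℂ) :=
  Finsupp.lsum ℂ fun m => ∑ i, (m i : ℂ) • Finsupp.lsingle (m - Pi.single i 1)

theorem laurentDeriv_single (p : ℕ) (m : Fin p → ℤ) (z : ℂ) :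
    laurentDeriv p (Finsupp.single m z) =
      ∑ i, (m i : ℂ) • Finsupp.single (m - Pi.single i 1) z := by
  simp [laurentDeriv]

theorem laurentDeriv_single_piSingle {p : ℕ} (i : Fin p) (n : ℤ) (z : ℂ) :
    laurentDeriv p (Finsupp.single (Pi.single i n) z) =
      (n : ℂ) • Finsupp.single (Pi.single i (n - 1)) z := by
  rw [laurentDeriv_single, Finset.sum_eq_single i (by intro j _ hj; simp [hj]) (by simp),
    Pi.single_eq_same, Pi.single_sub]

theorem neg_laurentDeriv_pow_single {p : ℕ} (i : Fin p) (n k : ℕ) :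
    ((-laurentDeriv p) ^ k) (Finsupp.single (Pi.single i (n : ℤ)) 1) =
      ((-1) ^ k * (n.descFactorial k : ℂ)) •
        Finsupp.single (Pi.single i ((n : ℤ) - k)) 1 := by
  induction k with
  | zero => simp
  | succ k ih =>
    rw [pow_succ', Module.End.mul_apply, ih, map_smul, LinearMap.neg_apply,
      laurentDeriv_single_piSingle, ← neg_smul, smul_smul, Nat.descFactorial_succ]
    rw [show (n : ℤ) - k - 1 = n - (k + 1 : ℕ) by push_cast; ring]
    congr 1
    rcases le_or_gt k n with hk | hk
    · push_cast [Nat.cast_sub hk]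
      ring
    · simp [Nat.descFactorial_of_lt hk]

theorem aeval_neg_laurentDeriv_apply_zero {p : ℕ} (i : Fin p) (g : ℂ[X]) :
    (aeval (-laurentDeriv p) g (Finsupp.single (Pi.single i (g.natDegree : ℤ)) 1)) 0 =
      g.leadingCoeff * ((-1) ^ g.natDegree * (g.natDegree.factorial : ℂ)) := by
  rw [aeval_eq_sum_range, LinearMap.sum_apply, Finsupp.finsetSum_apply,
    Finset.sum_eq_single g.natDegree]
  · simp [neg_laurentDeriv_pow_single, Nat.descFactorial_self]
  · intro k _ hkn
    have : (Pi.single i ((g.natDegree : ℤ) - k) : Fin p → ℤ) ≠ 0 := by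
      rw [Ne, Pi.single_eq_zero_iff]
      omega
    simp [neg_laurentDeriv_pow_single, this]
  · simp

/-- The map `r ⊗ t^m ↦ φ(r)(-(∂_{t₁} + ⋯ + ∂_{t_p})) t^m` induced by `φ : R → ℂ[∂]`. -/
def laurentMap (p : ℕ) (φ : R →ₗ[ℂ[X]] ℂ[X]) :
    ((Fin p → ℤ) →₀ R) →ₗ[ℂ] ((Fin p → ℤ) →₀ ℂ) :=
  Finsupp.lsum ℂ fun m =>
    LinearMap.applyₗ (Finsupp.single m (1 : ℂ)) ∘ₗ
      (aeval (-laurentDeriv p)).toLinearMap ∘ₗ φ.restrictScalars ℂ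

theorem laurentMap_single (p : ℕ) (φ : R →ₗ[ℂ[X]] ℂ[X]) (m : Fin p → ℤ) (r : R) :
    laurentMap p φ (Finsupp.single m r) =
      aeval (-laurentDeriv p) (φ r) (Finsupp.single m 1) := by
  simp [laurentMap]

theorem laurentMap_comp_DtildeP (p : ℕ) (φ : R →ₗ[ℂ[X]] ℂ[X]) :
    laurentMap p φ ∘ₗ DtildeP R p = 0 := by
  refine Finsupp.lhom_ext fun m r => ?_
  have h : aeval (-laurentDeriv p) (φ ((X : ℂ[X]) • r)) (Finsupp.single m 1) =
      -aeval (-laurentDeriv p) (φ r) (laurentDeriv p (Finsupp.single m 1)) := by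
    rw [map_smul, smul_eq_mul, mul_comm, map_mul, aeval_X, Module.End.mul_apply,
      LinearMap.neg_apply, map_neg]
  rw [LinearMap.comp_apply, DtildeP_single, map_add, map_sum, laurentMap_single, h,
    laurentDeriv_single, map_sum]
  simp only [map_smul, laurentMap_single, neg_add_cancel, LinearMap.zero_apply]

theorem NonnegCoeffsVanish.map_eq_zero {p : ℕ} (hp : 0 < p) {a : R}
    (h : NonnegCoeffsVanish p a) (φ : R →ₗ[ℂ[X]] ℂ[X]) : φ a = 0 := by
  let i₀ : Fin p := ⟨0, hp⟩
  obtain ⟨x, hx⟩ := h (Pi.single i₀ ((φ a).natDegree : ℤ)) fun i => by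
    rcases eq_or_ne i i₀ with rfl | hi <;> simp [*]
  have hzero := LinearMap.congr_fun (laurentMap_comp_DtildeP p φ) x
  rw [LinearMap.comp_apply, hx, laurentMap_single] at hzero
  have hlead := aeval_neg_laurentDeriv_apply_zero i₀ (φ a)
  rw [hzero] at hlead
  simpa [Nat.factorial_ne_zero] using hlead.symm

end

/-- let `R = (ℂ[∂] ⊗ V) ⊕ Tor R` be a finite `ℂ[∂]`-module (a free
finitely generated submodule `F` complementary to the torsion submodule).  For `a ∈ R`,
the monomials `a ⊗ t₁^{m₁}⋯t_p^{m_p}` vanish in `ℒie_p R` for all `m₁,…,m_p ≥ 0`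
iff `a` is a torsion element. -/
theorem stmt14 (R : Type*) [AddCommGroup R] [Module ℂ R] [Module (Polynomial ℂ) R]
    [IsScalarTower ℂ (Polynomial ℂ) R] [Module.Finite (Polynomial ℂ) R]
    (hdec : ∃ F : Submodule (Polynomial ℂ) R,
      Module.Free (Polynomial ℂ) F ∧ IsCompl F (Submodule.torsion (Polynomial ℂ) R))
    (p : ℕ) (hp : 0 < p) (a : R) :
    (∀ mm : Fin p → ℤ, (∀ i, 0 ≤ mm i) →
        Finsupp.single mm a ∈ LinearMap.range (DtildeP R p)) ↔
      a ∈ Submodule.torsion (Polynomial ℂ) R := by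
  constructor
  · intro h
    obtain ⟨F, hfree, hF⟩ := hdec
    suffices hproj : F.projectionOnto _ hF a = 0 by
      rwa [← LinearMap.mem_ker, Submodule.ker_projectionOnto] at hproj
    refine (Module.Free.chooseBasis (Polynomial ℂ) F).ext_elem fun i => ?_
    rw [map_zero, Finsupp.zero_apply]
    exact NonnegCoeffsVanish.map_eq_zero hp h
      ((Module.Free.chooseBasis (Polynomial ℂ) F).coord i ∘ₗ F.projectionOnto _ hF)
  · rintro ⟨f, hf⟩
    refine NonnegCoeffsVanish.of_smul hp (f : Polynomial ℂ) (nonZeroDivisors.ne_zero f.2) ?_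
    intro m _
    rw [show (f : Polynomial ℂ) • a = 0 from hf, Finsupp.single_zero]
    exact Submodule.zero_mem _
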